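/- A Singleton-optimal $(3,4)$-LRC over $GF(4)$ with minimum distance 12 and pairwise disjoint repair groups of size 6 has at most 21 repair groups. -/

import Mathlib

open scoped Classical

/-- Hamming weight of a vector. -/
noncomputable def wt {ι F : Type*} [Fintype ι] [Zero F] (x : ι → F) : ℕ :=
  (Finset.univ.filter (fun i => x i ≠ 0)).card

/-- Minimum distance of a linear code (minimum weight of a nonzero codeword). -/
noncomputable def minDist {ι F : Type*} [Fintype ι] [Field F]
    (C : Submodule F (ι → F)) : ℕ :=
  sInf {w | ∃ c ∈ C, c ≠ 0 ∧ wt c = w}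

/-- Restriction (puncturing) of a code to the coordinates in `S`. -/
noncomputable def puncture {ι F : Type*} [Fintype ι] [Field F]
    (C : Submodule F (ι → F)) (S : Finset ι) : Submodule F (↥S → F) :=
  C.map (LinearMap.funLeft F F (fun i : ↥S => (i : ι)))

/-- `C` is an `(r, δ)` locally repairable code with repair groups `R`:
the groups cover all coordinates, each has size at most `r + δ - 1`, and
each local (punctured) code has minimum distance at least `δ`. -/
def IsLRC {ι F : Type*} [Fintype ι] [Field F]
    (C : Submodule F (ι → F)) (r δ : ℕ) (R : Finset (Finset ι)) : Prop :=
  (∀ i : ι, ∃ S ∈ R, i ∈ S) ∧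
  (∀ S ∈ R, S.card ≤ r + δ - 1) ∧
  (∀ S ∈ R, ∀ c ∈ puncture C S, c ≠ 0 → δ ≤ wt c)

/-- No coordinate of the code is identically zero. -/
def NoZeroCoord {ι F : Type*} [Fintype ι] [Field F]
    (C : Submodule F (ι → F)) : Prop :=
  ∀ i : ι, ∃ c ∈ C, c i ≠ 0

/-- The Singleton-type bound for `(r, δ)`-LRCs is attained with equality:
`d = n - k + 1 - (⌈k/r⌉ - 1)(δ - 1)`. -/
def SingletonOptimal {ι F : Type*} [Fintype ι] [Field F]
    (C : Submodule F (ι → F)) (r δ : ℕ) : Prop :=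
  (minDist C : ℤ) = (Fintype.card ι : ℤ) - (Module.finrank F C : ℤ) + 1 -
    ((((Module.finrank F C + r - 1) / r : ℕ) : ℤ) - 1) * ((δ : ℤ) - 1)

/-- The dual code of `C` with respect to the standard bilinear form. -/
noncomputable def dualCode {ι F : Type*} [Fintype ι] [Field F]
    (C : Submodule F (ι → F)) : Submodule F (ι → F) where
  carrier := {x | ∀ c ∈ C, ∑ i, x i * c i = 0}
  add_mem' := by
    intro a b ha hb c hc
    simp only [Set.mem_setOf_eq] at ha hb ⊢
    simp [Pi.add_apply, add_mul, Finset.sum_add_distrib, ha c hc, hb c hc]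
  zero_mem' := by
    intro c hc
    simp
  smul_mem' := by
    intro t a ha c hc
    simp only [Set.mem_setOf_eq] at ha ⊢
    simp [Pi.smul_apply, smul_eq_mul, mul_assoc, ← Finset.mul_sum, ha c hc]

/-- Support of a (sub)code: coordinates where some codeword is nonzero. -/
noncomputable def codeSupp {ι F : Type*} [Fintype ι] [Field F]
    (D : Submodule F (ι → F)) : Finset ι :=
  Finset.univ.filter (fun i => ∃ x ∈ D, x i ≠ 0)

section helpers

variable {F : Type*} [Field F]

/-- A code of dimension larger than the size of `T` has a nonzero word vanishing on `T`. -/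
lemma exists_vanish {ι : Type*} [Fintype ι] (D : Submodule F (ι → F)) (T : Finset ι)
    (h : T.card < Module.finrank F D) : ∃ x ∈ D, x ≠ 0 ∧ ∀ i ∈ T, x i = 0 := by
  let f : D →ₗ[F] (T → F) := (LinearMap.funLeft F F (fun i : T => (i : ι))).comp D.subtype
  have hk : LinearMap.ker f ≠ ⊥ := by
    apply LinearMap.ker_ne_bot_of_finrank_lt
    simpa using h
  obtain ⟨x, hx, hx0⟩ := (Submodule.ne_bot_iff _).1 hk
  refine ⟨x, x.2, by simpa using hx0, fun i hi => ?_⟩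
  have := congrFun (LinearMap.mem_ker.1 hx) ⟨i, hi⟩
  simpa [f, LinearMap.funLeft] using this

lemma wt_add_zeros {ι : Type*} [Fintype ι] (x : ι → F) :
    wt x + (Finset.univ.filter (fun i => x i = 0)).card = Fintype.card ι := by
  have := Finset.card_filter_add_card_filter_not (s := (Finset.univ : Finset ι)) (fun i => x i ≠ 0)
  simp only [not_not, Finset.card_univ] at this
  exact this

lemma wt_le_of_vanish {ι : Type*} [Fintype ι] (x : ι → F) (T : Finset ι)
    (h : ∀ i ∈ T, x i = 0) : wt x + T.card ≤ Fintype.card ι := by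
  have h1 := wt_add_zeros x
  have : T.card ≤ (Finset.univ.filter (fun i => x i = 0)).card :=
    Finset.card_le_card (fun i hi => by simp [h i hi])
  omega

lemma local_dim_le {ι : Type*} [Fintype ι] (hι : Fintype.card ι = 6)
    (D : Submodule F (ι → F)) (hD : ∀ c ∈ D, c ≠ 0 → 4 ≤ wt c) : Module.finrank F D ≤ 3 := by
  by_contra hcon
  obtain ⟨T, -, hT⟩ := Finset.exists_subset_card_eq (s := (Finset.univ : Finset ι)) (n := 3)
    (by simp [hι])
  obtain ⟨x, hx, hx0, hxT⟩ := exists_vanish D T (by omega)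
  have := wt_le_of_vanish x T hxT
  have := hD x hx hx0
  omega

lemma full_dim_le {ι : Type*} [Fintype ι] (hι : Fintype.card ι = 6)
    (D : Submodule F (ι → F)) (hD : ∀ c ∈ D, c ≠ 0 → 6 ≤ wt c) : Module.finrank F D ≤ 1 := by
  by_contra hcon
  obtain ⟨T, -, hT⟩ := Finset.exists_subset_card_eq (s := (Finset.univ : Finset ι)) (n := 1)
    (by simp [hι])
  obtain ⟨x, hx, hx0, hxT⟩ := exists_vanish D T (by omega)
  have := wt_le_of_vanish x T hxT
  have := hD x hx hx0
  omega

/-- The nonzero words of weight at most five. -/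
noncomputable def lightSet {ι : Type*} [Fintype ι] [Fintype F] (D : Submodule F (ι → F)) :
    Finset D :=
  Finset.univ.filter (fun x : D => x ≠ 0 ∧ wt (x : ι → F) < 6)

lemma mem_lightSet {ι : Type*} [Fintype ι] [Fintype F] (D : Submodule F (ι → F)) (x : D) :
    x ∈ lightSet D ↔ x ≠ 0 ∧ wt (x : ι → F) < 6 := by
  simp [lightSet]

/-- The number of nonzero words of weight at most five is at least 45. -/
lemma light_card {ι : Type*} [Fintype ι] [Fintype F] (hF : Fintype.card F = 4)
    (hι : Fintype.card ι = 6)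
    (D : Submodule F (ι → F)) (hD : ∀ c ∈ D, c ≠ 0 → 4 ≤ wt c) (h3 : Module.finrank F D = 3) :
    45 ≤ (lightSet D).card := by
  unfold lightSet
  set L := Finset.univ.filter (fun x : D => x ≠ 0 ∧ wt (x : ι → F) < 6) with hL
  have h1 : ∀ i : ι, 15 ≤ (L.filter (fun x : D => (x : ι → F) i = 0)).card := by
    intro i
    let f : D →ₗ[F] F := (LinearMap.proj i).comp D.subtype
    have hr := LinearMap.finrank_range_add_finrank_ker f
    have hr1 : Module.finrank F (LinearMap.range f) ≤ 1 := by
      simpa using Submodule.finrank_le (LinearMap.range f)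
    have hk : 2 ≤ Module.finrank F (LinearMap.ker f) := by omega
    have hc : 16 ≤ Fintype.card (LinearMap.ker f) := by
      rw [Module.card_eq_pow_finrank (K := F), hF]
      calc 16 = 4 ^ 2 := by norm_num
        _ ≤ _ := Nat.pow_le_pow_right (by norm_num) hk
    rw [Fintype.card_subtype] at hc
    have hsub : (Finset.univ.filter (fun x : D => x ∈ LinearMap.ker f)).erase 0 ⊆
        L.filter (fun x : D => (x : ι → F) i = 0) := by
      intro x hx
      simp only [Finset.mem_erase, Finset.mem_filter, Finset.mem_univ, true_and,
        LinearMap.mem_ker] at hx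
      have hxi : (x : ι → F) i = 0 := by simpa [f] using hx.2
      have := wt_le_of_vanish (x : ι → F) {i} (by simpa using hxi)
      simp only [Finset.card_singleton] at this
      simp only [hL, Finset.mem_filter, Finset.mem_univ, true_and]
      exact ⟨⟨hx.1, by omega⟩, hxi⟩
    have := Finset.card_le_card hsub
    rw [Finset.card_erase_of_mem (by simp)] at this
    omega
  have h2 : ∑ i : ι, (L.filter (fun x : D => (x : ι → F) i = 0)).card =
      ∑ x ∈ L, (Finset.univ.filter (fun i => (x : ι → F) i = 0)).card := by
    simp only [Finset.card_filter]
    rw [Finset.sum_comm]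
  have h3 : ∑ x ∈ L, (Finset.univ.filter (fun i => (x : ι → F) i = 0)).card ≤ L.card * 2 := by
    rw [← smul_eq_mul]
    apply Finset.sum_le_card_nsmul
    intro x hx
    simp only [hL, Finset.mem_filter, Finset.mem_univ, true_and] at hx
    have := hD x x.2 (by simpa using hx.1)
    have := wt_add_zeros (x : ι → F)
    omega
  have h4 : 6 * 15 ≤ ∑ i : ι, (L.filter (fun x : D => (x : ι → F) i = 0)).card := by
    calc 6 * 15 = ∑ i : ι, 15 := by simp [hι]
      _ ≤ _ := Finset.sum_le_sum (fun i _ => h1 i)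
  omega

/-- Counting: disjoint light sets. -/
lemma count_light {J Q : Type*} (G : Finset J) (l : J → Finset Q) (U : Finset Q)
    (hU : ∀ j ∈ G, l j ⊆ U) (hl : ∀ j ∈ G, 45 ≤ (l j).card)
    (hd : ∀ i ∈ G, ∀ j ∈ G, i ≠ j → Disjoint (l i) (l j)) : G.card * 45 ≤ U.card := by
  have h1 : (G.biUnion l).card = ∑ j ∈ G, (l j).card := Finset.card_biUnion hd
  have h2 := Finset.card_le_card (Finset.biUnion_subset.2 hU)
  have h3 := Finset.card_nsmul_le_sum G (fun j => (l j).card) 45 hl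
  simp only [smul_eq_mul] at h3
  omega

lemma count_full {J Q : Type*} (G : Finset J) (l v : J → Finset Q) (U : Finset Q)
    (hv : ∀ j, v j ⊆ U) (hlv : ∀ j, l j ⊆ v j) (hl : ∀ j, 45 ≤ (l j).card)
    (hvc : ∀ j, (v j).card = 63)
    (hd : ∀ i j, i ≠ j → Disjoint (l i) (v j))
    (hvv : ∀ i j, i ≠ j → (v i ∩ v j).card ≤ 3) (hUc : U.card ≤ 1023) : G.card ≤ 21 := by
  by_contra hcon
  obtain ⟨a, b, c, ha, hb, hc, hab, hac, hbc⟩ := Finset.two_lt_card_iff.1 (show 2 < G.card by omega)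
  set W := v a ∪ v b ∪ v c with hW
  set G' := ((G.erase a).erase b).erase c with hG'
  have hG'c : G'.card + 3 = G.card := by
    rw [hG', Finset.card_erase_of_mem (by simp [hc, hac.symm, hbc.symm]),
      Finset.card_erase_of_mem (by simp [hb, hab.symm]), Finset.card_erase_of_mem ha]
    omega
  have h1 := count_light G' l (U \ W) (by
    intro j hj
    simp only [hG', Finset.mem_erase] at hj
    intro x hx
    have e1 := fun k hk => Finset.disjoint_left.1 (hd j k hk) hx
    simp only [hW, Finset.mem_sdiff, Finset.mem_union]
    refine ⟨hv j (hlv j hx), ?_⟩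
    rintro ((h | h) | h)
    · exact e1 a hj.2.2.1 h
    · exact e1 b hj.2.1 h
    · exact e1 c hj.1 h) (fun j _ => hl j)
    (fun i _ j _ hij => Finset.disjoint_of_subset_right (hlv j) (hd i j hij))
  have hWU : W ⊆ U := Finset.union_subset (Finset.union_subset (hv a) (hv b)) (hv c)
  have h2 := Finset.card_sdiff_add_card_eq_card hWU
  have h3 := Finset.card_union_add_card_inter (v a) (v b)
  have h4 := Finset.card_union_add_card_inter (v a ∪ v b) (v c)
  have h5 : ((v a ∪ v b) ∩ v c).card ≤ 6 := by
    rw [Finset.union_inter_distrib_right]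
    have := Finset.card_union_le (v a ∩ v c) (v b ∩ v c)
    have := hvv a c hac
    have := hvv b c hbc
    omega
  have h6 := hvv a b hab
  have := hvc a
  have := hvc b
  have := hvc c
  rw [← hW] at h4
  omega

end helpers

/-- Main argument, over an arbitrary field with four elements. -/
lemma main_bound {F : Type*} [Field F] [Fintype F] (hF : Fintype.card F = 4) (n : ℕ)
    (C : Submodule F (Fin n → F)) (R : Finset (Finset (Fin n)))
    (hcov : ∀ i, ∃ S ∈ R, i ∈ S)
    (hloc : ∀ S ∈ R, ∀ c ∈ puncture C S, c ≠ 0 → 4 ≤ wt c)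
    (hsize : ∀ S ∈ R, S.card = 6)
    (hmin : ∀ c ∈ C, c ≠ 0 → 12 ≤ wt c)
    (hk : Module.finrank F C + 5 = 3 * R.card) : R.card ≤ 21 := by
  by_contra hcon
  let ψ : C →ₗ[F] (∀ S : R, puncture C (S : Finset (Fin n))) :=
    LinearMap.pi fun S =>
      ((LinearMap.funLeft F F (fun i : ((S : Finset (Fin n)) : Finset (Fin n)) => (i : Fin n))).domRestrict C).codRestrict
        (puncture C (S : Finset (Fin n)))
        (fun c => Submodule.mem_map_of_mem c.2)
  have hψ : ∀ (c : C) (S : R) (i : (S : Finset (Fin n))),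
      ((ψ c S : _) : ↥S.1 → F) i = (c : Fin n → F) i := fun c S i => rfl
  have hinj : Function.Injective ψ := by
    rw [← LinearMap.ker_eq_bot, LinearMap.ker_eq_bot']
    intro c hc
    ext i
    obtain ⟨S, hS, hi⟩ := hcov i
    have := hψ c ⟨S, hS⟩ ⟨i, hi⟩
    rw [hc] at this
    simpa using this.symm
  let Q := (∀ S : R, puncture C (S : Finset (Fin n))) ⧸ LinearMap.range ψ
  have hcardS : ∀ S : R, Fintype.card (S : Finset (Fin n)) = 6 := fun S => by
    simpa using hsize S S.2
  let d : R → ℕ := fun S => Module.finrank F (puncture C (S : Finset (Fin n)))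
  have hd3 : ∀ S, d S ≤ 3 := fun S => local_dim_le (hcardS S) _ (hloc S S.2)
  have hQ : Module.finrank F Q + Module.finrank F C = ∑ S, d S := by
    have h1 := Submodule.finrank_quotient_add_finrank (LinearMap.range ψ)
    rw [LinearMap.finrank_range_of_inj hinj, Module.finrank_pi_fintype] at h1
    exact h1
  let φ : ∀ S : R, puncture C (S : Finset (Fin n)) →ₗ[F] Q := fun S =>
    (LinearMap.range ψ).mkQ.comp (LinearMap.single F (fun S : R => puncture C (S : Finset (Fin n))) S)
  -- the key distance property
  have key : ∀ (S T : R), S ≠ T → ∀ (x : puncture C (S : Finset (Fin n)))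
      (y : puncture C (T : Finset (Fin n))), φ S x = φ T y →
      wt (x : ↥S.1 → F) + wt (y : ↥T.1 → F) < 12 →
      x = 0 ∧ y = 0 := by
    intro S T hST x y hxy hw
    have h1 : (Pi.single S x - Pi.single T y : ∀ S : R, puncture C (S : Finset (Fin n)))
        ∈ LinearMap.range ψ := (Submodule.Quotient.eq _).1 hxy
    obtain ⟨c, hc⟩ := h1
    have hcS : ψ c S = x := by rw [hc]; simp [hST]
    have hcT : ψ c T = -y := by rw [hc]; simp [hST.symm]
    have hcU : ∀ U, U ≠ S → U ≠ T → ψ c U = 0 := by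
      intro U h1 h2; rw [hc]; simp [h1, h2]
    have hc0 : c = 0 := by
      by_contra hne
      have h12 := hmin c c.2 (by simpa using hne)
      have hsub : Finset.univ.filter (fun i => (c : Fin n → F) i ≠ 0) ⊆
          ((Finset.univ.filter (fun i => (x : ↥S.1 → F) i ≠ 0)).image Subtype.val) ∪
          ((Finset.univ.filter (fun i => (y : ↥T.1 → F) i ≠ 0)).image Subtype.val) := by
        intro i hi
        simp only [Finset.mem_filter, Finset.mem_univ, true_and] at hi
        obtain ⟨U, hU, hiU⟩ := hcov i
        have h2 := hψ c ⟨U, hU⟩ ⟨i, hiU⟩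
        rw [Finset.mem_union]
        by_cases hUS : (⟨U, hU⟩ : R) = S
        · left
          subst hUS
          rw [hcS] at h2
          refine Finset.mem_image.2 ⟨⟨i, hiU⟩, ?_, rfl⟩
          simpa [h2] using hi
        · by_cases hUT : (⟨U, hU⟩ : R) = T
          · right
            subst hUT
            rw [hcT] at h2
            refine Finset.mem_image.2 ⟨⟨i, hiU⟩, ?_, rfl⟩
            simp only [Finset.mem_filter, Finset.mem_univ, true_and]
            intro h0
            apply hi
            simp only at h2
            rw [← h2]
            simp [h0]
          · rw [hcU _ hUS hUT] at h2
            exact absurd h2.symm hi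
      have := (Finset.card_le_card hsub).trans ((Finset.card_union_le _ _).trans
        (add_le_add Finset.card_image_le Finset.card_image_le))
      unfold wt at h12 hw
      omega
    rw [hc0] at hcS hcT
    simp only [map_zero, Pi.zero_apply] at hcS hcT
    exact ⟨hcS.symm, by simpa using hcT.symm⟩
  have hwle : ∀ (S : R) (x : ↥S.1 → F), wt x ≤ 6 := by
    intro S x
    have := wt_add_zeros x
    have := hcardS S
    omega
  have hwz : ∀ (S : R), wt (0 : ↥S.1 → F) = 0 := by
    intro S; simp [wt]
  have hφinj : ∀ S, Function.Injective (φ S) := by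
    intro S
    rw [← LinearMap.ker_eq_bot, LinearMap.ker_eq_bot']
    intro x hx
    obtain ⟨T, hT⟩ : ∃ T : R, T ≠ S := by
      haveI : Nontrivial R := by
        rw [← Fintype.one_lt_card_iff_nontrivial]; simp; omega
      exact exists_ne S
    refine (key S T hT.symm x 0 (by rw [hx, map_zero]) ?_).1
    have := hwle S x
    have := hwz T
    simp only [Submodule.coe_zero]
    omega
  haveI : Fintype Q := Fintype.ofFinite Q
  have hQc : Fintype.card Q = 4 ^ Module.finrank F Q := by
    rw [Module.card_eq_pow_finrank (K := F), hF]
  let U : Finset Q := Finset.univ.erase 0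
  have hUc : U.card = 4 ^ Module.finrank F Q - 1 := by
    rw [Finset.card_erase_of_mem (Finset.mem_univ _), Finset.card_univ, hQc]
  let l : R → Finset Q := fun S =>
    (lightSet (puncture C (S : Finset (Fin n)))).image (φ S)
  let v : R → Finset Q := fun S =>
    (Finset.univ.filter (fun x : puncture C (S : Finset (Fin n)) => x ≠ 0)).image (φ S)
  have hlv : ∀ S, l S ⊆ v S := fun S =>
    Finset.image_subset_image (fun x hx => by
      simp only [Finset.mem_filter, Finset.mem_univ, true_and]; exact ((mem_lightSet _ _).1 hx).1)
  have hvU : ∀ S, v S ⊆ U := by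
    intro S q hq
    obtain ⟨x, hx, rfl⟩ := Finset.mem_image.1 hq
    simp only [Finset.mem_filter, Finset.mem_univ, true_and] at hx
    refine Finset.mem_erase.2 ⟨fun h => hx (hφinj S (by rw [h, map_zero])), Finset.mem_univ _⟩
  have hl : ∀ S, d S = 3 → 45 ≤ (l S).card := by
    intro S hS
    rw [Finset.card_image_of_injective _ (hφinj S)]
    exact light_card hF (hcardS S) _ (hloc S S.2) hS
  have hlvd : ∀ S T, S ≠ T → Disjoint (l S) (v T) := by
    intro S T hST
    rw [Finset.disjoint_left]
    intro q hq hq'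
    obtain ⟨x, hx, rfl⟩ := Finset.mem_image.1 hq
    obtain ⟨y, hy, hxy⟩ := Finset.mem_image.1 hq'
    rw [mem_lightSet] at hx
    have := hwle T y
    exact hx.1 (key S T hST x y hxy.symm (by omega)).1
  have hRc : Fintype.card R = R.card := by simp
  by_cases hall : ∀ S, d S = 3
  · have hsum : ∑ S, d S = 3 * R.card := by
      simp [hall, mul_comm]
    have hQ5 : Module.finrank F Q = 5 := by omega
    have hvc : ∀ S, (v S).card = 63 := by
      intro S
      rw [Finset.card_image_of_injective _ (hφinj S), Finset.filter_ne' Finset.univ,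
        Finset.card_erase_of_mem (Finset.mem_univ _), Finset.card_univ,
        Module.card_eq_pow_finrank (K := F), hF]
      have := hall S
      simp only [d] at this
      rw [this]
      norm_num
    have hvv : ∀ S T, S ≠ T → (v S ∩ v T).card ≤ 3 := by
      intro S T hST
      let K : Submodule F (↥S.1 → F) :=
        ((LinearMap.range (φ T)).comap (φ S)).map (puncture C (S : Finset (Fin n))).subtype
      have hK : Module.finrank F K ≤ 1 := by
        apply full_dim_le (hcardS S)
        rintro _ ⟨x, ⟨y, hxy⟩, rfl⟩ hx0
        by_contra hlt
        have := hwle T y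
        simp only [Submodule.subtype_apply] at hlt
        exact hx0 (by simp [(key S T hST x y hxy.symm (by omega)).1])
      have hKc : Fintype.card K ≤ 4 := by
        rw [Module.card_eq_pow_finrank (K := F), hF]
        calc 4 ^ Module.finrank F K ≤ 4 ^ 1 := Nat.pow_le_pow_right (by norm_num) hK
          _ = 4 := by norm_num
      let g : (Finset.univ.erase (0 : K) : Finset K) → Q := fun z => 
        φ S ⟨z.1.1, by
          obtain ⟨x, -, hx⟩ := z.1.2
          rw [← hx]; exact x.2⟩
      have hsub : v S ∩ v T ⊆ Finset.univ.image g := by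
        intro q hq
        obtain ⟨hq1, hq2⟩ := Finset.mem_inter.1 hq
        obtain ⟨x, hx, rfl⟩ := Finset.mem_image.1 hq1
        obtain ⟨y, hy, hxy⟩ := Finset.mem_image.1 hq2
        simp only [Finset.mem_filter, Finset.mem_univ, true_and] at hx
        refine Finset.mem_image.2 ⟨⟨⟨x, ⟨x, ⟨y, hxy⟩, rfl⟩⟩, ?_⟩, Finset.mem_univ _, rfl⟩
        refine Finset.mem_erase.2 ⟨fun h => hx ?_, Finset.mem_univ _⟩
        have := congrArg Subtype.val h
        simpa using this
      have h1 := (Finset.card_le_card hsub).trans Finset.card_image_le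
      rw [Finset.card_univ, Fintype.card_coe, Finset.card_erase_of_mem (Finset.mem_univ _),
        Finset.card_univ] at h1
      omega
    have := count_full Finset.univ l v U hvU hlv (fun S => hl S (hall S)) hvc hlvd hvv
      (by rw [hUc, hQ5]; norm_num)
    rw [Finset.card_univ, hRc] at this
    exact hcon this
  · push Not at hall
    obtain ⟨S₀, hS₀⟩ := hall
    let G : Finset R := Finset.univ.filter (fun S => d S = 3)
    have h1 : ∑ S, d S + (Finset.univ.filter (fun S => ¬ d S = 3)).card ≤ 3 * R.card := by
      rw [Finset.card_filter, ← Finset.sum_add_distrib, ← hRc, mul_comm, ← smul_eq_mul,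
        ← Finset.card_univ]
      apply Finset.sum_le_card_nsmul
      intro S _
      have := hd3 S
      split_ifs <;> omega
    have h2 := Finset.card_filter_add_card_filter_not (s := (Finset.univ : Finset R))
      (fun S => d S = 3)
    rw [Finset.card_univ, hRc] at h2
    have h3 : 0 < (Finset.univ.filter (fun S => ¬ d S = 3)).card :=
      Finset.card_pos.2 ⟨S₀, by simp [hS₀]⟩
    have hQ4 : Module.finrank F Q ≤ 4 := by omega
    have hU4 : U.card ≤ 256 := by
      rw [hUc]
      have : 4 ^ Module.finrank F Q ≤ 4 ^ 4 := Nat.pow_le_pow_right (by norm_num) hQ4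
      omega
    have h5 := count_light G l U (fun S _ => (hlv S).trans (hvU S))
      (fun S hS => hl S (Finset.mem_filter.1 hS).2)
      (fun S _ T _ hST => Finset.disjoint_of_subset_right (hlv T) (hlvd S T hST))
    have h6 : G.card + (Finset.univ.filter (fun S => ¬ d S = 3)).card = R.card := h2
    omega

theorem stmt_19 (n : ℕ)
    (C : Submodule (GaloisField 2 2) (Fin n → GaloisField 2 2))
    (R : Finset (Finset (Fin n)))
    (hLRC : IsLRC C 3 4 R) (hnz : NoZeroCoord C)
    (hopt : SingletonOptimal C 3 4)
    (hd : minDist C = 12)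
    (hsize : ∀ S ∈ R, S.card = 6)
    (hdisj : ∀ S ∈ R, ∀ T ∈ R, S ≠ T → Disjoint S T) :
    R.card ≤ 21 := by
  obtain ⟨hcov, -, hloc⟩ := hLRC
  haveI : Fintype (GaloisField 2 2) := Fintype.ofFinite _
  have hF : Fintype.card (GaloisField 2 2) = 4 := by
    rw [← Nat.card_eq_fintype_card, GaloisField.card 2 2 (by norm_num)]
    norm_num
  have hn : n = R.card * 6 := by
    have h1 : R.biUnion id = Finset.univ := by
      ext i
      simpa using hcov i
    have h2 := Finset.card_biUnion (s := R) (t := id) hdisj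
    rw [h1, Finset.card_univ, Fintype.card_fin] at h2
    simp only [id] at h2
    rw [Finset.sum_congr rfl hsize] at h2
    simpa using h2
  have hmin : ∀ c ∈ C, c ≠ 0 → 12 ≤ wt c := by
    intro c hc hc0
    rw [← hd]
    exact Nat.sInf_le ⟨c, hc, hc0, rfl⟩
  refine main_bound hF n C R hcov hloc hsize hmin ?_
  unfold SingletonOptimal at hopt
  rw [hd, Fintype.card_fin] at hopt
  push_cast at hopt
  omega
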